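/- The plane sextic C defined by X⁶ + Y⁶ + Z⁶ − 10(X³Y³ + Y³Z³ + Z³X³) = 0 is smooth over K, and its automorphism group Aut(C) ⊂ PGL₃(K) equals the Hessian group Hess₂₁₆, namely the subgroup of PGL₃(K) generated by S = diag(1, ζ₃, ζ₃⁻¹), U = diag(1, 1, ζ₃), T = [Y:Z:X], and V = the class of the matrix with rows (1,1,1), (1,ζ₃,ζ₃⁻¹), (1,ζ₃⁻¹,ζ₃); in particular |Aut(C)| = 216. -/

import Mathlib

open MvPolynomial

/-- `GL₃(K)`: the group of invertible `3 × 3` matrices over `K`. -/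
abbrev GL3 (K : Type*) [Field K] := (Matrix (Fin 3) (Fin 3) K)ˣ

/-- `PGL₃(K)`: the quotient of `GL₃(K)` by its center (the scalar matrices). -/
abbrev PGL3 (K : Type*) [Field K] := GL3 K ⧸ Subgroup.center (GL3 K)

variable {K : Type*} [Field K]

/-- The substitution `F(X,Y,Z) ↦ F(A·(X,Y,Z)ᵗ)` for a `3 × 3` matrix `A`. -/
noncomputable def matAct (A : Matrix (Fin 3) (Fin 3) K) (F : MvPolynomial (Fin 3) K) :
    MvPolynomial (Fin 3) K :=
  aeval (fun i => ∑ j, C (A i j) * X j) F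

lemma matAct_one (F : MvPolynomial (Fin 3) K) : matAct 1 F = F := by
  unfold matAct
  have h : (fun i => ∑ j, C ((1 : Matrix (Fin 3) (Fin 3) K) i j) * X j)
      = (X : Fin 3 → MvPolynomial (Fin 3) K) := by
    funext i
    rw [Finset.sum_eq_single i]
    · simp
    · intro b _ hb
      simp [Matrix.one_apply, Ne.symm hb]
    · simp
  rw [h, aeval_X_left_apply]

lemma matAct_matAct (A B : Matrix (Fin 3) (Fin 3) K) (F : MvPolynomial (Fin 3) K) :
    matAct B (matAct A F) = matAct (A * B) F := by
  unfold matAct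
  rw [← AlgHom.comp_apply, comp_aeval]
  have h : (fun i => (aeval fun i => ∑ j, C (B i j) * X j) (∑ j, C (A i j) * X j))
      = fun i => ∑ j : Fin 3, C ((A * B) i j) * (X j : MvPolynomial (Fin 3) K) := by
    funext i
    simp only [map_sum, map_mul, aeval_C, aeval_X, algebraMap_eq, Finset.mul_sum]
    rw [Finset.sum_comm]
    refine Finset.sum_congr rfl fun k _ => ?_
    rw [Matrix.mul_apply, map_sum, Finset.sum_mul]
    refine Finset.sum_congr rfl fun j _ => ?_
    rw [map_mul, mul_assoc]
  rw [h]

lemma matAct_smul (A : Matrix (Fin 3) (Fin 3) K) (c : K) (F : MvPolynomial (Fin 3) K) :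
    matAct A (c • F) = c • matAct A F :=
  map_smul (aeval fun i => ∑ j, C (A i j) * X j) c F

/-- The class of a matrix `A` in `PGL₃(K)` (junk value `1` if `A` is not invertible). -/
noncomputable def pgl (A : Matrix (Fin 3) (Fin 3) K) : PGL3 K := by
  classical
  exact if h : IsUnit A then (QuotientGroup.mk h.unit : PGL3 K) else 1

/-- `F` defines a smooth plane sextic: `F` is homogeneous of degree `6`, and `F` together with
its partial derivatives have no common zero besides the origin. -/
def IsSmoothSextic (F : MvPolynomial (Fin 3) K) : Prop :=
  F.IsHomogeneous 6 ∧
    ∀ p : Fin 3 → K, eval p F = 0 → (∀ i, eval p (pderiv i F) = 0) → p = 0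

/-- The automorphism group of the plane curve `F = 0`: the subgroup of `PGL₃(K)` consisting of
the classes of matrices `A ∈ GL₃(K)` with `F(A·(X,Y,Z)ᵗ) = λ·F(X,Y,Z)` for some `λ ∈ K×`. -/
noncomputable def planeAut (F : MvPolynomial (Fin 3) K) : Subgroup (PGL3 K) where
  carrier := {g | ∃ A : GL3 K, (QuotientGroup.mk A : PGL3 K) = g ∧
    ∃ c : K, c ≠ 0 ∧ matAct (A : Matrix (Fin 3) (Fin 3) K) F = c • F}
  one_mem' := ⟨1, rfl, 1, one_ne_zero, by rw [Units.val_one, matAct_one, one_smul]⟩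
  mul_mem' := by
    rintro g h ⟨A, rfl, c, hc, hA⟩ ⟨B, rfl, d, hd, hB⟩
    exact ⟨A * B, rfl, c * d, mul_ne_zero hc hd, by
      rw [Units.val_mul, ← matAct_matAct, hA, matAct_smul, hB, smul_smul]⟩
  inv_mem' := by
    rintro g ⟨A, rfl, c, hc, hA⟩
    refine ⟨A⁻¹, rfl, c⁻¹, inv_ne_zero hc, ?_⟩
    rw [eq_inv_smul_iff₀ hc, ← matAct_smul, ← hA, matAct_matAct, ← Units.val_mul,
      mul_inv_cancel, Units.val_one, matAct_one]

/-! ### Linear substitutions and Hessian matrices -/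

lemma eval_matAct (A : Matrix (Fin 3) (Fin 3) K) (F : MvPolynomial (Fin 3) K) (p : Fin 3 → K) :
    eval p (matAct A F) = eval (A.mulVec p) F := by
  induction F using MvPolynomial.induction_on with
  | C a => simp [matAct]
  | add f g hf hg => simp_all [matAct]
  | mul_X f i hf => simp_all [matAct, Matrix.mulVec, dotProduct]

/-- The chain rule for linear substitutions. -/
lemma pderiv_matAct (A : Matrix (Fin 3) (Fin 3) K) (F : MvPolynomial (Fin 3) K) (j : Fin 3) :
    pderiv j (matAct A F) = ∑ i, C (A i j) * matAct A (pderiv i F) := by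
  induction F using MvPolynomial.induction_on with
  | C a => simp [matAct]
  | add f g hf hg =>
    simp only [matAct, map_add, mul_add, Finset.sum_add_distrib] at *
    rw [hf, hg]
  | mul_X f k hf =>
    have hX : pderiv j (∑ l, C (A k l) * X l : MvPolynomial (Fin 3) K) = C (A k j) := by
      simp [pderiv_X, Pi.single_apply]
    simp only [matAct, map_mul, aeval_X, pderiv_mul, map_add] at *
    rw [hf, hX]
    simp only [mul_add, Finset.sum_add_distrib, pderiv_X, Pi.single_apply, Finset.sum_mul]
    congr 1
    · exact Finset.sum_congr rfl fun _ _ => by ring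
    · simp [apply_ite, mul_comm]

/-- The matrix of second partial derivatives of `F` at the point `p`. -/
noncomputable def hessianAt (F : MvPolynomial (Fin 3) K) (p : Fin 3 → K) :
    Matrix (Fin 3) (Fin 3) K :=
  Matrix.of fun i j => eval p (pderiv i (pderiv j F))

lemma hessianAt_matAct (A : Matrix (Fin 3) (Fin 3) K) (F : MvPolynomial (Fin 3) K)
    (p : Fin 3 → K) :
    hessianAt (matAct A F) p = A.transpose * hessianAt F (A.mulVec p) * A := by
  ext i j
  simp only [hessianAt, Matrix.of_apply, pderiv_matAct, map_sum, pderiv_C_mul, map_mul,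
    eval_C, eval_matAct, Matrix.mul_apply, Matrix.transpose_apply, Finset.sum_mul,
    Finset.mul_sum]
  exact Finset.sum_congr rfl fun _ _ => Finset.sum_congr rfl fun _ _ => by ring

lemma hessianAt_smul (c : K) (F : MvPolynomial (Fin 3) K) (p : Fin 3 → K) :
    hessianAt (c • F) p = c • hessianAt F p := by
  ext i j
  simp [hessianAt, smul_eval]

/-- If `A` preserves `F` up to a scalar, it preserves the zero locus of the Hessian of `F`. -/
lemma det_hessianAt_eq_zero_of_mulVec {A : Matrix (Fin 3) (Fin 3) K}
    {F : MvPolynomial (Fin 3) K} {c : K} (hc : c ≠ 0) (hA : matAct A F = c • F) {p : Fin 3 → K}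
    (hp : (hessianAt F (A.mulVec p)).det = 0) : (hessianAt F p).det = 0 := by
  have h := congrArg Matrix.det (hessianAt_matAct A F p)
  rw [hA, hessianAt_smul, Matrix.det_smul, Matrix.det_mul, Matrix.det_mul, hp] at h
  simpa [hc] using h

/-! ### Classes of matrices in `PGL₃` -/

lemma pgl_of_isUnit {A : Matrix (Fin 3) (Fin 3) K} (h : IsUnit A) :
    pgl A = (QuotientGroup.mk h.unit : PGL3 K) := by
  simp [pgl, h]

lemma pgl_val (A : GL3 K) : pgl (A : Matrix (Fin 3) (Fin 3) K) = QuotientGroup.mk A := by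
  rw [pgl_of_isUnit A.isUnit]
  congr 1
  exact Units.ext rfl

lemma pgl_mul {A B : Matrix (Fin 3) (Fin 3) K} (hA : IsUnit A) (hB : IsUnit B) :
    pgl (A * B) = pgl A * pgl B := by
  obtain ⟨A, rfl⟩ := hA
  obtain ⟨B, rfl⟩ := hB
  rw [← Units.val_mul, pgl_val, pgl_val, pgl_val, QuotientGroup.mk_mul]

lemma pgl_eq_pgl_iff {A B : Matrix (Fin 3) (Fin 3) K} (hA : IsUnit A) (hB : IsUnit B) :
    pgl A = pgl B ↔ ∃ s : K, B = s • A := by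
  obtain ⟨A, rfl⟩ := hA
  obtain ⟨B, rfl⟩ := hB
  rw [pgl_val, pgl_val, QuotientGroup.eq]
  erw [Matrix.GeneralLinearGroup.mem_center_iff_val_mem_range_scalar]
  constructor
  · rintro ⟨s, hs⟩
    refine ⟨s, ?_⟩
    have : (B : Matrix (Fin 3) (Fin 3) K) = A * (A⁻¹ * B : GL3 K) := by
      rw [← Units.val_mul, mul_inv_cancel_left]
    rw [this]
    erw [← hs]
    simp [Matrix.smul_eq_mul_diagonal, Matrix.scalar_apply]
  · rintro ⟨s, hs⟩
    refine ⟨s, ?_⟩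
    erw [Units.val_mul]
    rw [hs, mul_smul_comm, ← Units.val_mul, inv_mul_cancel, Units.val_one]
    simp [Matrix.smul_eq_diagonal_mul, Matrix.scalar_apply]

/-- The matrix `A` is invertible and preserves `F` up to a nonzero scalar. -/
def Preserves (A : Matrix (Fin 3) (Fin 3) K) (F : MvPolynomial (Fin 3) K) : Prop :=
  IsUnit A ∧ ∃ c : K, c ≠ 0 ∧ matAct A F = c • F

lemma Preserves.pgl_mem {A : Matrix (Fin 3) (Fin 3) K} {F : MvPolynomial (Fin 3) K}
    (h : Preserves A F) : pgl A ∈ planeAut F :=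
  ⟨h.1.unit, (pgl_of_isUnit h.1).symm, h.2⟩

lemma exists_preserves_of_mem {F : MvPolynomial (Fin 3) K} {g : PGL3 K} (hg : g ∈ planeAut F) :
    ∃ A, Preserves A F ∧ pgl A = g := by
  obtain ⟨A, rfl, h⟩ := hg
  exact ⟨A, ⟨A.isUnit, h⟩, pgl_val A⟩

lemma Preserves.mul {A B : Matrix (Fin 3) (Fin 3) K} {F : MvPolynomial (Fin 3) K}
    (hA : Preserves A F) (hB : Preserves B F) : Preserves (A * B) F := by
  obtain ⟨uA, c, hc, hA⟩ := hA
  obtain ⟨uB, d, hd, hB⟩ := hB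
  exact ⟨uA.mul uB, c * d, mul_ne_zero hc hd, by
    rw [← matAct_matAct, hA, matAct_smul, hB, smul_smul]⟩

lemma Preserves.exists_mul_eq {A N : Matrix (Fin 3) (Fin 3) K} {F : MvPolynomial (Fin 3) K}
    (hA : Preserves A F) (hN : Preserves N F) : ∃ B, Preserves B F ∧ B * N = A := by
  obtain ⟨uA, c, hc, hA⟩ := hA
  obtain ⟨⟨N, rfl⟩, d, hd, hN⟩ := hN
  have h : matAct (N⁻¹ : GL3 K) F = d⁻¹ • F := by
    rw [eq_inv_smul_iff₀ hd, ← matAct_smul, ← hN, matAct_matAct, ← Units.val_mul,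
      mul_inv_cancel, Units.val_one, matAct_one]
  refine ⟨A * (N⁻¹ : GL3 K), ⟨uA.mul (Units.isUnit _), c * d⁻¹,
    mul_ne_zero hc (inv_ne_zero hd), ?_⟩, ?_⟩
  · rw [← matAct_matAct, hA, matAct_smul, h, smul_smul]
  · rw [mul_assoc, ← Units.val_mul, inv_mul_cancel, Units.val_one, mul_one]

/-! ### The sextic and the twelve lines of the Hesse arrangement -/

/-- The sextic form `X⁶ + Y⁶ + Z⁶ − 10(X³Y³ + Y³Z³ + Z³X³)`. -/
noncomputable def hessianSextic (K : Type*) [Field K] : MvPolynomial (Fin 3) K :=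
  X 0 ^ 6 + X 1 ^ 6 + X 2 ^ 6
    - 10 * (X 0 ^ 3 * X 1 ^ 3 + X 1 ^ 3 * X 2 ^ 3 + X 2 ^ 3 * X 0 ^ 3)

lemma eval_hessianSextic (p : Fin 3 → K) : eval p (hessianSextic K) =
    p 0 ^ 6 + p 1 ^ 6 + p 2 ^ 6
      - 10 * (p 0 ^ 3 * p 1 ^ 3 + p 1 ^ 3 * p 2 ^ 3 + p 2 ^ 3 * p 0 ^ 3) := by
  simp [hessianSextic]

lemma pderiv_hessianSextic (i : Fin 3) : pderiv i (hessianSextic K) =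
    6 * X i ^ 2 * (X i ^ 3 - 5 * (X (i + 1) ^ 3 + X (i + 2) ^ 3)) := by
  have h10 (j : Fin 3) : pderiv j (10 : MvPolynomial (Fin 3) K) = 0 := (pderiv j).map_natCast 10
  fin_cases i <;>
  · simp [hessianSextic, pderiv_X, h10]
    ring

lemma isSmoothSextic_hessianSextic [CharZero K] : IsSmoothSextic (hessianSextic K) := by
  constructor
  · have hX (i : Fin 3) (n : ℕ) : (X i ^ n : MvPolynomial (Fin 3) K).IsHomogeneous n := by
      simpa using (isHomogeneous_X K i).pow n
    have h3 (i j : Fin 3) : (X i ^ 3 * X j ^ 3 : MvPolynomial (Fin 3) K).IsHomogeneous 6 :=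
      (hX i 3).mul (hX j 3)
    have h10 : (10 : MvPolynomial (Fin 3) K).IsHomogeneous 0 := isHomogeneous_C _ (10 : K)
    refine ((((hX 0 6).add (hX 1 6)).add (hX 2 6)).sub ?_)
    simpa using h10.mul (((h3 0 1).add (h3 1 2)).add (h3 2 0))
  · intro p _ h
    have key (i : Fin 3) : p i ^ 3 = 0 ∨ p i ^ 3 = 5 * (p (i + 1) ^ 3 + p (i + 2) ^ 3) := by
      simpa [pderiv_hessianSextic, map_ofNat, sub_eq_zero] using h i
    have h0 := key 0
    have h1 := key 1
    have h2 := key 2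
    simp only [Fin.isValue, Fin.reduceAdd, zero_add] at h0 h1 h2
    have h12 : (1 : Fin 3) + 2 = 0 := rfl
    have h21 : (2 : Fin 3) + 1 = 0 := rfl
    funext i
    suffices p i ^ 3 = 0 from pow_eq_zero_iff three_ne_zero |>.1 this
    revert i
    generalize p 0 ^ 3 = x at *
    rw [Fin.forall_fin_succ, Fin.forall_fin_two]
    grind

lemma det_hessianAt_hessianSextic (p : Fin 3 → K) :
    (hessianAt (hessianSextic K) p).det = 108000 * (p 0 * p 1 * p 2 *
      ((p 0 ^ 3 + p 1 ^ 3 + p 2 ^ 3) ^ 3 - 27 * p 0 ^ 3 * p 1 ^ 3 * p 2 ^ 3)) := by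
  have h6 (j : Fin 3) : pderiv j (6 : MvPolynomial (Fin 3) K) = 0 := (pderiv j).map_natCast 6
  have h5 (j : Fin 3) : pderiv j (5 : MvPolynomial (Fin 3) K) = 0 := (pderiv j).map_natCast 5
  have h12 : (1 : Fin 3) + 2 = 0 := rfl
  have h21 : (2 : Fin 3) + 1 = 0 := rfl
  simp [hessianAt, pderiv_hessianSextic, Matrix.det_fin_three, pderiv_X,
    Pi.single_apply, h5, h6, h12, h21]
  ring

/-- The twelve lines of the Hesse arrangement, as linear forms. -/
def hesseLine (ζ : K) : Fin 3 ⊕ Fin 3 × Fin 3 → Fin 3 → K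
  | .inl k => Pi.single k 1
  | .inr (i, j) => ![1, ζ ^ (i : ℕ), ζ ^ (j : ℕ)]

lemma IsPrimitiveRoot.sq_add_self_add_one {ζ : K} (hζ : IsPrimitiveRoot ζ 3) :
    ζ ^ 2 + ζ + 1 = 0 := by
  have h := hζ.geom_sum_eq_zero (by norm_num)
  simp only [Finset.sum_range_succ, Finset.sum_range_zero] at h
  linear_combination h

lemma prod_add_pow_mul {ζ : K} (h : ζ ^ 2 + ζ + 1 = 0) (u z : K) :
    ∏ j : Fin 3, (u + ζ ^ (j : ℕ) * z) = u ^ 3 + z ^ 3 := by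
  simp only [Fin.prod_univ_three, Fin.val_zero, Fin.val_one, Fin.val_two]
  linear_combination (u ^ 2 * z + u * z ^ 2 * ζ + z ^ 3 * (ζ - 1)) * h

lemma prod_hesseLine {ζ : K} (hζ : IsPrimitiveRoot ζ 3) (p : Fin 3 → K) :
    ∏ k, hesseLine ζ k ⬝ᵥ p = p 0 * p 1 * p 2 *
      ((p 0 ^ 3 + p 1 ^ 3 + p 2 ^ 3) ^ 3 - 27 * p 0 ^ 3 * p 1 ^ 3 * p 2 ^ 3) := by
  have h := hζ.sq_add_self_add_one
  have h3 := hζ.pow_eq_one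
  have hs (i j : Fin 3) : hesseLine ζ (.inr (i, j)) ⬝ᵥ p =
      (p 0 + ζ ^ (i : ℕ) * p 1) + ζ ^ (j : ℕ) * p 2 := by
    simp [hesseLine, dotProduct, Fin.sum_univ_three]
  have h0 (k : Fin 3) : hesseLine ζ (.inl k) ⬝ᵥ p = p k := by simp [hesseLine]
  simp only [Fintype.prod_sum_type, Fintype.prod_prod_type, hs, h0, prod_add_pow_mul h]
  simp only [Fin.prod_univ_three, Fin.val_zero, Fin.val_one, Fin.val_two]
  congr 1
  have h1 : (p 0 + ζ ^ 1 * p 1) ^ 3 = p 0 ^ 3 + p 1 ^ 3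
      + ζ * (3 * p 0 ^ 2 * p 1) + ζ ^ 2 * (3 * p 0 * p 1 ^ 2) := by
    linear_combination p 1 ^ 3 * h3
  have h2 : (p 0 + ζ ^ 2 * p 1) ^ 3 = p 0 ^ 3 + p 1 ^ 3
      + ζ ^ 2 * (3 * p 0 ^ 2 * p 1) + ζ * (3 * p 0 * p 1 ^ 2) := by
    linear_combination (p 1 ^ 3 * (ζ ^ 3 + 1) + 3 * ζ * p 0 * p 1 ^ 2) * h3
  have hn (M a b : K) : (M + a + b) * (M + ζ * a + ζ ^ 2 * b) * (M + ζ ^ 2 * a + ζ * b) =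
      M ^ 3 + a ^ 3 + b ^ 3 - 3 * M * a * b := by
    grind
  rw [h1, h2]
  linear_combination hn (p 0 ^ 3 + p 1 ^ 3 + p 2 ^ 3) (3 * p 0 ^ 2 * p 1) (3 * p 0 * p 1 ^ 2)

lemma exists_eq_zero_of_prod_dotProduct [Infinite K] {ι : Type*} [Fintype ι]
    (w : ι → Fin 3 → K) (h : ∀ q, ∏ k, w k ⬝ᵥ q = 0) : ∃ k, w k = 0 := by
  have hp : ∏ k, (∑ i, C (w k i) * X i : MvPolynomial (Fin 3) K) = 0 :=
    MvPolynomial.funext fun q => by simpa [map_prod, dotProduct] using h q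
  obtain ⟨k, -, hk⟩ := Finset.prod_eq_zero_iff.1 hp
  refine ⟨k, funext fun i => ?_⟩
  simpa [Pi.single_apply] using congrArg (eval (Pi.single i 1)) hk

open scoped Matrix in
/-- The rows of a matrix preserving the sextic are multiples of lines of the Hesse arrangement. -/
lemma Preserves.exists_crossProduct_eq_zero [CharZero K] {ζ : K} (hζ : IsPrimitiveRoot ζ 3)
    {A : Matrix (Fin 3) (Fin 3) K} (hA : Preserves A (hessianSextic K)) (i : Fin 3) :
    ∃ k, crossProduct (hesseLine ζ k) (A i) = 0 := by
  obtain ⟨-, c, hc, hA⟩ := hA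
  refine exists_eq_zero_of_prod_dotProduct _ fun q => ?_
  have h := det_hessianAt_eq_zero_of_mulVec hc hA (p := crossProduct (A i) q) (by
    rw [det_hessianAt_hessianSextic, ← prod_hesseLine hζ, mul_eq_zero]
    refine .inr (Finset.prod_eq_zero (Finset.mem_univ (.inl i)) ?_)
    simp [hesseLine, Matrix.mulVec, dot_self_cross])
  rw [det_hessianAt_hessianSextic, ← prod_hesseLine hζ] at h
  have h' := (mul_eq_zero.1 h).resolve_left (by norm_num)
  rw [← h']
  refine Finset.prod_congr rfl fun k _ => ?_
  rw [dotProduct_comm, triple_product_permutation]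

/-! ### Generators of the Hessian group -/

/-- The diagonal matrix `diag(1, ζ^i, ζ^j)`. -/
def diagMat (ζ : K) (i j : ℕ) : Matrix (Fin 3) (Fin 3) K :=
  !![1, 0, 0; 0, ζ ^ i, 0; 0, 0, ζ ^ j]

/-- The transposition `[X:Z:Y]`. -/
def swapMat (K : Type*) [Field K] : Matrix (Fin 3) (Fin 3) K :=
  !![1, 0, 0; 0, 0, 1; 0, 1, 0]

/-- The cyclic permutation `[Y:Z:X]`. -/
def cycleMat (K : Type*) [Field K] : Matrix (Fin 3) (Fin 3) K :=
  !![0, 1, 0; 0, 0, 1; 1, 0, 0]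

/-- The matrix `(ζ^(ij))` with `0 ≤ i, j ≤ 2`. -/
def fourierMat (ζ : K) : Matrix (Fin 3) (Fin 3) K :=
  !![1, 1, 1; 1, ζ, ζ⁻¹; 1, ζ⁻¹, ζ]

lemma IsPrimitiveRoot.inv_eq_sq {ζ : K} (hζ : IsPrimitiveRoot ζ 3) : ζ⁻¹ = ζ ^ 2 :=
  inv_eq_of_mul_eq_one_right (by linear_combination hζ.pow_eq_one)

lemma isUnit_of_det_ne_zero {A : Matrix (Fin 3) (Fin 3) K} (h : A.det ≠ 0) : IsUnit A :=
  (Matrix.isUnit_iff_isUnit_det A).2 h.isUnit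

lemma preserves_of_eval [Infinite K] {A : Matrix (Fin 3) (Fin 3) K} {F : MvPolynomial (Fin 3) K}
    (hA : A.det ≠ 0) {c : K} (hc : c ≠ 0) (h : ∀ p, eval (A.mulVec p) F = c * eval p F) :
    Preserves A F :=
  ⟨isUnit_of_det_ne_zero hA, c, hc, MvPolynomial.funext fun p => by
    rw [eval_matAct, h, smul_eval]⟩

lemma preserves_diagMat [CharZero K] {ζ : K} (hζ : IsPrimitiveRoot ζ 3) (i j : ℕ) :
    Preserves (diagMat ζ i j) (hessianSextic K) := by
  have h0 : ζ ≠ 0 := hζ.ne_zero (by norm_num)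
  have h3 (n : ℕ) : (ζ ^ n) ^ 3 = 1 := by rw [pow_right_comm, hζ.pow_eq_one, one_pow]
  have h6 (n : ℕ) : (ζ ^ n) ^ 6 = 1 := by rw [pow_mul _ 3 2, h3, one_pow]
  refine preserves_of_eval (c := 1) ?_ one_ne_zero fun p => ?_
  · simp [diagMat, Matrix.det_fin_three, h0]
  · simp only [eval_hessianSextic]
    simp [diagMat, Matrix.mulVec, dotProduct, Fin.sum_univ_three, mul_pow, h3, h6]

lemma preserves_swapMat [CharZero K] : Preserves (swapMat K) (hessianSextic K) := by
  refine preserves_of_eval (c := 1) ?_ one_ne_zero fun p => ?_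
  · simp [swapMat, Matrix.det_fin_three]
  · simp only [eval_hessianSextic]
    simp [swapMat, Matrix.mulVec, dotProduct, Fin.sum_univ_three]
    ring

lemma preserves_cycleMat [CharZero K] : Preserves (cycleMat K) (hessianSextic K) := by
  refine preserves_of_eval (c := 1) ?_ one_ne_zero fun p => ?_
  · simp [cycleMat, Matrix.det_fin_three]
  · simp only [eval_hessianSextic]
    simp [cycleMat, Matrix.mulVec, dotProduct, Fin.sum_univ_three]
    ring

lemma det_fourierMat_ne_zero [CharZero K] {ζ : K} (hζ : IsPrimitiveRoot ζ 3) :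
    (fourierMat ζ).det ≠ 0 := by
  have h := hζ.sq_add_self_add_one
  have h0 : (3 : K) ≠ 0 := by norm_num
  simp [fourierMat, Matrix.det_fin_three, hζ.inv_eq_sq]
  grind

lemma preserves_fourierMat [CharZero K] {ζ : K} (hζ : IsPrimitiveRoot ζ 3) :
    Preserves (fourierMat ζ) (hessianSextic K) := by
  have h := hζ.sq_add_self_add_one
  have h3 := hζ.pow_eq_one
  refine preserves_of_eval (c := -27) (det_fourierMat_ne_zero hζ) (by norm_num) fun p => ?_
  simp only [eval_hessianSextic]
  simp [fourierMat, Matrix.mulVec, dotProduct, Fin.sum_univ_three, hζ.inv_eq_sq]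
  generalize p 0 = x
  generalize p 1 = y
  generalize p 2 = z
  have h1 : (x + ζ * y + ζ ^ 2 * z) ^ 3 = x ^ 3 + y ^ 3 + z ^ 3 + 6 * (x * y * z)
      + 3 * ζ * (x ^ 2 * y + y ^ 2 * z + z ^ 2 * x)
      + 3 * ζ ^ 2 * (x ^ 2 * z + y ^ 2 * x + z ^ 2 * y) := by
    grind
  have h2 : (x + ζ ^ 2 * y + ζ * z) ^ 3 = x ^ 3 + y ^ 3 + z ^ 3 + 6 * (x * y * z)
      + 3 * ζ ^ 2 * (x ^ 2 * y + y ^ 2 * z + z ^ 2 * x)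
      + 3 * ζ * (x ^ 2 * z + y ^ 2 * x + z ^ 2 * y) := by
    grind
  have hF (s m a b : K) :
      (s + 6 * m + 3 * a + 3 * b) ^ 2 + (s + 6 * m + 3 * ζ * a + 3 * ζ ^ 2 * b) ^ 2
      + (s + 6 * m + 3 * ζ ^ 2 * a + 3 * ζ * b) ^ 2
      - 10 * ((s + 6 * m + 3 * a + 3 * b) * (s + 6 * m + 3 * ζ * a + 3 * ζ ^ 2 * b)
      + (s + 6 * m + 3 * ζ * a + 3 * ζ ^ 2 * b) * (s + 6 * m + 3 * ζ ^ 2 * a + 3 * ζ * b)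
      + (s + 6 * m + 3 * ζ ^ 2 * a + 3 * ζ * b) * (s + 6 * m + 3 * a + 3 * b)) =
      -27 * ((s + 6 * m) ^ 2 - 12 * a * b) := by
    grind
  rw [pow_mul (x + ζ * y + ζ ^ 2 * z) 3 2, pow_mul (x + ζ ^ 2 * y + ζ * z) 3 2, h1, h2]
  linear_combination hF (x ^ 3 + y ^ 3 + z ^ 3) (x * y * z) (x ^ 2 * y + y ^ 2 * z + z ^ 2 * x)
    (x ^ 2 * z + y ^ 2 * x + z ^ 2 * y)

lemma fourierMat_mul_self {ζ : K} (hζ : IsPrimitiveRoot ζ 3) :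
    fourierMat ζ * fourierMat ζ = (3 : K) • swapMat K := by
  have h := hζ.sq_add_self_add_one
  ext i j
  fin_cases i <;> fin_cases j <;>
    simp [fourierMat, swapMat, Matrix.mul_apply, Fin.sum_univ_three, hζ.inv_eq_sq] <;> grind

lemma diagMat_eq_diagonal (ζ : K) (i j : ℕ) :
    diagMat ζ i j = Matrix.diagonal ![1, ζ ^ i, ζ ^ j] := by
  ext a b
  fin_cases a <;> fin_cases b <;> simp [diagMat]

lemma pgl_pow {A : Matrix (Fin 3) (Fin 3) K} (hA : IsUnit A) (n : ℕ) :
    pgl (A ^ n) = pgl A ^ n := by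
  induction n with
  | zero => simpa using pgl_val (1 : GL3 K)
  | succ n ih => rw [pow_succ, pgl_mul (hA.pow n) hA, ih, pow_succ]

lemma diagMat_eq_mul {ζ : K} (hζ : ζ ≠ 0) (i j : ℕ) : diagMat ζ i j =
    !![1, 0, 0; 0, ζ, 0; 0, 0, ζ⁻¹] ^ i * !![1, 0, 0; 0, 1, 0; 0, 0, ζ] ^ (i + j) := by
  have h1 : !![1, 0, 0; 0, ζ, 0; 0, 0, ζ⁻¹] = Matrix.diagonal ![1, ζ, ζ⁻¹] := by
    ext a b
    fin_cases a <;> fin_cases b <;> simp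
  have h2 : !![1, 0, 0; 0, 1, 0; 0, 0, ζ] = Matrix.diagonal ![1, 1, ζ] := by
    ext a b
    fin_cases a <;> fin_cases b <;> simp
  rw [h1, h2, Matrix.diagonal_pow, Matrix.diagonal_pow, Matrix.diagonal_mul_diagonal,
    diagMat_eq_diagonal]
  congr 1
  funext a
  fin_cases a <;> simp [pow_add, hζ]

/-! ### Normal forms -/

/-- Matrices whose first row is `(1, 0, 0)`, representing the stabilizer of the line `X = 0`. -/
def stabMat (ζ : K) (d : Fin 3 × Fin 3 × Bool) : Matrix (Fin 3) (Fin 3) K :=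
  diagMat ζ d.1 d.2.1 * if d.2.2 then swapMat K else 1

/-- A matrix in the Hessian group with first row `hesseLine ζ k`. -/
def lineMat (ζ : K) : Fin 3 ⊕ Fin 3 × Fin 3 → Matrix (Fin 3) (Fin 3) K
  | .inl k => cycleMat K ^ (k : ℕ)
  | .inr (i, j) => fourierMat ζ * diagMat ζ i j

lemma lineMat_zero (ζ : K) (k : Fin 3 ⊕ Fin 3 × Fin 3) : lineMat ζ k 0 = hesseLine ζ k := by
  rcases k with k | ⟨i, j⟩
  · funext a
    fin_cases k <;> fin_cases a <;> simp [lineMat, hesseLine, cycleMat, pow_two]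
  · funext a
    fin_cases a <;> simp [lineMat, hesseLine, fourierMat, diagMat, Matrix.mul_apply,
      Fin.sum_univ_three]

lemma stabMat_zero (ζ : K) (d : Fin 3 × Fin 3 × Bool) : stabMat ζ d 0 = Pi.single 0 1 := by
  obtain ⟨i, j, _ | _⟩ := d <;> funext a <;> fin_cases a <;>
    simp [stabMat, diagMat, swapMat, Matrix.mul_apply, Fin.sum_univ_three]

lemma Preserves.pow {A : Matrix (Fin 3) (Fin 3) K} {F : MvPolynomial (Fin 3) K}
    (hA : Preserves A F) (n : ℕ) : Preserves (A ^ n) F := by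
  induction n with
  | zero => exact ⟨by simp, 1, one_ne_zero, by rw [pow_zero, matAct_one, one_smul]⟩
  | succ n ih => rw [pow_succ]; exact ih.mul hA

lemma preserves_stabMat [CharZero K] {ζ : K} (hζ : IsPrimitiveRoot ζ 3)
    (d : Fin 3 × Fin 3 × Bool) : Preserves (stabMat ζ d) (hessianSextic K) := by
  obtain ⟨i, j, _ | _⟩ := d
  · simpa [stabMat] using preserves_diagMat hζ i j
  · simpa [stabMat] using (preserves_diagMat hζ i j).mul preserves_swapMat

lemma preserves_lineMat [CharZero K] {ζ : K} (hζ : IsPrimitiveRoot ζ 3)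
    (k : Fin 3 ⊕ Fin 3 × Fin 3) : Preserves (lineMat ζ k) (hessianSextic K) := by
  rcases k with k | ⟨i, j⟩
  · exact preserves_cycleMat.pow k
  · exact (preserves_fourierMat hζ).mul (preserves_diagMat hζ i j)

lemma eq_smul_hesseLine_of_crossProduct_eq_zero {ζ : K} {k : Fin 3 ⊕ Fin 3 × Fin 3}
    {v : Fin 3 → K} (h : crossProduct (hesseLine ζ k) v = 0) : ∃ s : K, v = s • hesseLine ζ k := by
  have h0 := congrFun h 0
  have h1 := congrFun h 1
  have h2 := congrFun h 2
  rcases k with k | ⟨i, j⟩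
  · refine ⟨v k, funext fun a => ?_⟩
    fin_cases k <;> fin_cases a <;> simp_all [hesseLine, cross_apply]
  · refine ⟨v 0, funext fun a => ?_⟩
    simp only [hesseLine, cross_apply] at h0 h1 h2
    fin_cases a <;> simp_all [hesseLine] <;> grind

lemma hesseLine_injective {ζ s : K} (hζ : IsPrimitiveRoot ζ 3) {k l : Fin 3 ⊕ Fin 3 × Fin 3}
    (h : hesseLine ζ l = s • hesseLine ζ k) : l = k := by
  have h0 : ζ ≠ 0 := hζ.ne_zero (by norm_num)
  have hne (q : Fin 3 × Fin 3) (a : Fin 3) : hesseLine ζ (.inr q) a ≠ 0 := by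
    fin_cases a <;> simp [hesseLine, h0]
  have hz (a : Fin 3) : hesseLine ζ (.inl a) (a + 1) = 0 := by
    fin_cases a <;> simp [hesseLine]
  rcases k with k | q <;> rcases l with l | r
  · have := congrFun h l
    by_contra hlk
    have hlk' : l ≠ k := fun e => hlk (e ▸ rfl)
    simp [hesseLine, hlk'] at this
  · exact absurd (by simpa [hz] using congrFun h (k + 1)) (hne r (k + 1))
  · have h1 := congrFun h (l + 1)
    have h2 := congrFun h l
    simp only [hz, Pi.smul_apply, smul_eq_mul, zero_eq_mul, hne, or_false] at h1
    simp [h1, hesseLine] at h2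
  · have h1 := congrFun h 0
    have h2 := congrFun h 1
    have h3 := congrFun h 2
    obtain rfl : 1 = s := by simpa [hesseLine] using h1
    simp only [hesseLine, one_smul, Matrix.cons_val] at h2 h3
    have e1 := Fin.ext (hζ.pow_inj r.1.isLt q.1.isLt h2)
    have e2 := Fin.ext (hζ.pow_inj r.2.isLt q.2.isLt h3)
    rw [Prod.ext e1 e2]

lemma stabMat_injective {ζ s : K} (hζ : IsPrimitiveRoot ζ 3) {d e : Fin 3 × Fin 3 × Bool}
    (h : stabMat ζ e = s • stabMat ζ d) : e = d := by
  have h0 : ζ ≠ 0 := hζ.ne_zero (by norm_num)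
  have h00 := congrFun (congrFun h 0) 0
  have h11 := congrFun (congrFun h 1) 1
  have h12 := congrFun (congrFun h 1) 2
  have h21 := congrFun (congrFun h 2) 1
  have h22 := congrFun (congrFun h 2) 2
  obtain ⟨i, j, _ | _⟩ := d <;> obtain ⟨i', j', _ | _⟩ := e <;>
    simp [stabMat, diagMat, swapMat, Matrix.mul_apply, Fin.sum_univ_three, h0]
      at h00 h11 h12 h21 h22
  · subst h00
    rw [one_mul] at h11 h22
    rw [Fin.ext (hζ.pow_inj i'.isLt i.isLt h11), Fin.ext (hζ.pow_inj j'.isLt j.isLt h22)]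
  · subst h00
    rw [one_mul] at h12 h21
    rw [Fin.ext (hζ.pow_inj i'.isLt i.isLt h12), Fin.ext (hζ.pow_inj j'.isLt j.isLt h21)]

lemma eq_zero_of_forall_sum_eq_zero [Infinite K] {n : ℕ} (a : Fin n → K)
    (h : ∀ y : K, ∑ i, a i * y ^ (i : ℕ) = 0) : a = 0 := by
  have hp : ∑ i, Polynomial.C (a i) * Polynomial.X ^ (i : ℕ) = 0 :=
    Polynomial.funext fun y => by simpa [Polynomial.eval_finsetSum] using h y
  funext i
  simpa [Polynomial.finsetSum_coeff, Polynomial.coeff_C_mul, Polynomial.coeff_X_pow,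
    Fin.val_inj] using congrArg (Polynomial.coeff · i) hp

/-- If a substitution preserves the form `Y⁶ - 10Y³Z³ + Z⁶` up to a scalar, then the coefficients
of `Y⁵Z`, `YZ⁵` and `Y²Z⁴` in the transformed form vanish. -/
lemma coeff_binary_sextic [CharZero K] {a b c d e : K}
    (h : ∀ y : K, (a * y + b) ^ 6 + (c * y + d) ^ 6 - 10 * ((a * y + b) ^ 3 * (c * y + d) ^ 3) =
      e * (y ^ 6 + 1 - 10 * y ^ 3)) :
    a ^ 5 * b + c ^ 5 * d - 5 * (a ^ 3 * c ^ 2 * d + a ^ 2 * b * c ^ 3) = 0 ∧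
    a * b ^ 5 + c * d ^ 5 - 5 * (b ^ 3 * c * d ^ 2 + a * b ^ 2 * d ^ 3) = 0 ∧
    15 * (a ^ 2 * b ^ 4 + c ^ 2 * d ^ 4) - 10 * (3 * a ^ 2 * b * d ^ 3
      + 9 * a * b ^ 2 * c * d ^ 2 + 3 * b ^ 3 * c ^ 2 * d) = 0 := by
  have h0 := eq_zero_of_forall_sum_eq_zero ![b ^ 6 + d ^ 6 - 10 * b ^ 3 * d ^ 3 - e,
    6 * a * b ^ 5 + 6 * c * d ^ 5 - 30 * (b ^ 3 * c * d ^ 2 + a * b ^ 2 * d ^ 3),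
    15 * (a ^ 2 * b ^ 4 + c ^ 2 * d ^ 4) - 10 * (3 * a ^ 2 * b * d ^ 3
      + 9 * a * b ^ 2 * c * d ^ 2 + 3 * b ^ 3 * c ^ 2 * d),
    20 * (a ^ 3 * b ^ 3 + c ^ 3 * d ^ 3) - 10 * (a ^ 3 * d ^ 3 + 9 * a ^ 2 * b * c * d ^ 2
      + 9 * a * b ^ 2 * c ^ 2 * d + b ^ 3 * c ^ 3) + 10 * e,
    15 * (a ^ 4 * b ^ 2 + c ^ 4 * d ^ 2) - 10 * (3 * a ^ 3 * c * d ^ 2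
      + 9 * a ^ 2 * b * c ^ 2 * d + 3 * a * b ^ 2 * c ^ 3),
    6 * a ^ 5 * b + 6 * c ^ 5 * d - 30 * (a ^ 3 * c ^ 2 * d + a ^ 2 * b * c ^ 3),
    a ^ 6 + c ^ 6 - 10 * a ^ 3 * c ^ 3 - e] fun y => by
      simp [Fin.sum_univ_succ]
      linear_combination h y
  have h1 := congrFun h0 1
  have h2 := congrFun h0 2
  have h5 := congrFun h0 5
  simp only [Matrix.cons_val, Pi.zero_apply] at h1 h2 h5
  have h6 : (6 : K) ≠ 0 := by norm_num
  exact ⟨mul_left_cancel₀ h6 (by linear_combination h5),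
    mul_left_cancel₀ h6 (by linear_combination h1), h2⟩

/-- A substitution preserving the binary form `Y⁶ - 10Y³Z³ + Z⁶` up to a scalar whose rows are
proportional to lines of the Hesse arrangement is monomial. -/
lemma binary_sextic_monomial [CharZero K] {a b c d e : K} (hdet : a * d - b * c ≠ 0)
    (h : ∀ y : K, (a * y + b) ^ 6 + (c * y + d) ^ 6 - 10 * ((a * y + b) ^ 3 * (c * y + d) ^ 3) =
      e * (y ^ 6 + 1 - 10 * y ^ 3))
    (h1 : a = 0 ∨ b = 0 ∨ a ^ 3 = b ^ 3) (h2 : c = 0 ∨ d = 0 ∨ c ^ 3 = d ^ 3) :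
    b = 0 ∧ c = 0 ∨ a = 0 ∧ d = 0 := by
  obtain ⟨e5, e1, e2⟩ := coeff_binary_sextic h
  by_cases ha : a = 0
  · subst ha
    have hc : c ≠ 0 := by rintro rfl; simp at hdet
    right
    simpa [hc] using e5
  by_cases hb : b = 0
  · subst hb
    have hd : d ≠ 0 := by rintro rfl; simp at hdet
    left
    simpa [hd] using e1
  by_cases hc : c = 0
  · subst hc
    simp [ha, hb] at e5
  by_cases hd : d = 0
  · subst hd
    simp [ha, hb] at e1
  exfalso
  replace h1 : b ^ 3 = a ^ 3 := by simpa [ha, hb, eq_comm] using h1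
  replace h2 : d ^ 3 = c ^ 3 := by simpa [hc, hd, eq_comm] using h2
  obtain ⟨w, rfl⟩ : ∃ w, b = a * w := ⟨b / a, by field_simp⟩
  obtain ⟨x, rfl⟩ : ∃ x, d = c * x := ⟨d / c, by field_simp⟩
  have hw : w ^ 3 = 1 := by
    rw [mul_pow] at h1
    exact mul_left_cancel₀ (pow_ne_zero 3 ha) (by rw [h1, mul_one])
  have hx : x ^ 3 = 1 := by
    rw [mul_pow] at h2
    exact mul_left_cancel₀ (pow_ne_zero 3 hc) (by rw [h2, mul_one])
  have hwx : w ≠ x := by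
    rintro rfl
    exact hdet (by ring)
  have hs : w ^ 2 + w * x + x ^ 2 = 0 :=
    mul_left_cancel₀ (sub_ne_zero.2 hwx) (by linear_combination hw - hx)
  have h30 : 180 * (a ^ 3 * c ^ 3) * (w + x - 2 * (w ^ 2 * x ^ 2)) = 0 := by
    linear_combination -60 * e5 + 4 * e2 + (120 * a ^ 3 * c ^ 3 * x - 60 * a ^ 6 * w) * hw
      + (120 * a ^ 3 * c ^ 3 * w - 60 * c ^ 6 * x) * hx
  have h18 : (180 : K) * (a ^ 3 * c ^ 3) ≠ 0 := by simp [ha, hc]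
  have h4 := (mul_eq_zero.1 h30).resolve_left h18
  have h5 : w + x + w ^ 2 * x ^ 2 = 0 := by linear_combination w ^ 2 * hs - (w + x) * hw
  have h6 : 3 * (w ^ 2 * x ^ 2) = 0 := by linear_combination h5 - h4
  have hw0 : w ≠ 0 := by rintro rfl; simp at hw
  have hx0 : x ≠ 0 := by rintro rfl; simp at hx
  simp [hw0, hx0] at h6

lemma cube_eq_of_eq_smul_hesseLine {ζ t : K} (hζ : IsPrimitiveRoot ζ 3) {v : Fin 3 → K}
    {k : Fin 3 ⊕ Fin 3 × Fin 3} (hv : v = t • hesseLine ζ k) :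
    (v 0 = 0 ∧ v 1 = 0) ∨ (v 0 = 0 ∧ v 2 = 0) ∨ (v 1 = v 2 ∧ v 1 = 0) ∨
      v 1 ≠ 0 ∧ v 2 ≠ 0 ∧ v 1 ^ 3 = v 2 ^ 3 := by
  subst hv
  rcases k with k | ⟨i, j⟩
  · fin_cases k <;> simp [hesseLine]
  · have h0 : ζ ≠ 0 := hζ.ne_zero (by norm_num)
    have h3 (n : ℕ) : (ζ ^ n) ^ 3 = 1 := by rw [pow_right_comm, hζ.pow_eq_one, one_pow]
    by_cases htz : t = 0 <;> simp [hesseLine, mul_pow, h3, htz, h0]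

set_option maxHeartbeats 1000000 in
lemma Preserves.eq_smul_stabMat [CharZero K] {ζ s : K} (hζ : IsPrimitiveRoot ζ 3)
    {B : Matrix (Fin 3) (Fin 3) K} (hB : Preserves B (hessianSextic K))
    (h0 : B 0 = s • Pi.single 0 1) : ∃ d, ∃ t : K, B = t • stabMat ζ d := by
  have hdet := ((Matrix.isUnit_iff_isUnit_det B).1 hB.1).ne_zero
  obtain ⟨k, hk⟩ := hB.exists_crossProduct_eq_zero hζ 1
  obtain ⟨l, hl⟩ := hB.exists_crossProduct_eq_zero hζ 2
  obtain ⟨t, ht⟩ := eq_smul_hesseLine_of_crossProduct_eq_zero hk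
  obtain ⟨r, hr⟩ := eq_smul_hesseLine_of_crossProduct_eq_zero hl
  obtain ⟨-, e, he, hB⟩ := hB
  have hr1 := cube_eq_of_eq_smul_hesseLine hζ ht
  have hr2 := cube_eq_of_eq_smul_hesseLine hζ hr
  have h00 : B 0 0 = s := by simp [h0]
  have h01 : B 0 1 = 0 := by simp [h0]
  have h02 : B 0 2 = 0 := by simp [h0]
  have hev (x y z : K) : (s * x) ^ 6 + (B 1 0 * x + B 1 1 * y + B 1 2 * z) ^ 6
      + (B 2 0 * x + B 2 1 * y + B 2 2 * z) ^ 6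
      - 10 * ((s * x) ^ 3 * (B 1 0 * x + B 1 1 * y + B 1 2 * z) ^ 3
        + (B 1 0 * x + B 1 1 * y + B 1 2 * z) ^ 3 * (B 2 0 * x + B 2 1 * y + B 2 2 * z) ^ 3
        + (B 2 0 * x + B 2 1 * y + B 2 2 * z) ^ 3 * (s * x) ^ 3) =
      e * (x ^ 6 + y ^ 6 + z ^ 6 - 10 * (x ^ 3 * y ^ 3 + y ^ 3 * z ^ 3 + z ^ 3 * x ^ 3)) := by
    have := congrArg (eval ![x, y, z]) hB
    rw [eval_matAct, smul_eval, eval_hessianSextic, eval_hessianSextic] at this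
    simpa [Matrix.mulVec, dotProduct, Fin.sum_univ_three, h00, h01, h02] using this
  rw [Matrix.det_fin_three, h00, h01, h02] at hdet
  have hs : s ≠ 0 := by rintro rfl; simp at hdet
  have hd : B 1 1 * B 2 2 - B 1 2 * B 2 1 ≠ 0 := fun h => hdet (by linear_combination s * h)
  have hcube {u v : K} (h : u ^ 3 = v ^ 3) (hv : v ≠ 0) : ∃ i : Fin 3, u = v * ζ ^ (i : ℕ) := by
    obtain ⟨i, hi, h⟩ := hζ.eq_pow_of_pow_eq_one (ξ := u / v)
      (by rw [div_pow, h, div_self (pow_ne_zero 3 hv)])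
    exact ⟨⟨i, hi⟩, by simp only [h]; field_simp⟩
  have hmon := binary_sextic_monomial hd (e := e)
    (fun y => by linear_combination hev 0 y 1) (by tauto) (by tauto)
  have key {b c : K} (h1 : s ^ 6 = e) (h2 : b ^ 6 = e) (h3 : s ^ 3 * b ^ 3 = e) :
      b ^ 3 = s ^ 3 := by
    have := pow_eq_zero_iff (n := 2) two_ne_zero |>.1
      (show (b ^ 3 - s ^ 3) ^ 2 = 0 by linear_combination h1 + h2 - 2 * h3)
    exact sub_eq_zero.1 this
  have e100 := hev 1 0 0
  have e010 := hev 0 1 0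
  have e001 := hev 0 0 1
  have e110 := hev 1 1 0
  have e101 := hev 1 0 1
  rcases hmon with ⟨h12, h21⟩ | ⟨h11, h22⟩
  · have h10 : B 1 0 = 0 := by grind
    have h20 : B 2 0 = 0 := by grind
    simp only [h12, h21, h10, h20] at e100 e010 e001 e110 e101
    have hb : B 1 1 ^ 3 = s ^ 3 := by grind
    have hc : B 2 2 ^ 3 = s ^ 3 := by grind
    obtain ⟨i, hi⟩ := hcube hb hs
    obtain ⟨j, hj⟩ := hcube hc hs
    refine ⟨(i, j, false), s, ?_⟩
    ext a b
    fin_cases a <;> fin_cases b <;> simp [stabMat, diagMat, *]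
  · have h10 : B 1 0 = 0 := by grind
    have h20 : B 2 0 = 0 := by grind
    simp only [h11, h22, h10, h20] at e100 e010 e001 e110 e101
    have hb : B 1 2 ^ 3 = s ^ 3 := by grind
    have hc : B 2 1 ^ 3 = s ^ 3 := by grind
    obtain ⟨i, hi⟩ := hcube hb hs
    obtain ⟨j, hj⟩ := hcube hc hs
    refine ⟨(i, j, true), s, ?_⟩
    ext a b
    fin_cases a <;> fin_cases b <;>
      simp [stabMat, diagMat, swapMat, *]

lemma single_vecMul_lineMat (ζ : K) (k : Fin 3 ⊕ Fin 3 × Fin 3) :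
    Matrix.vecMul (Pi.single 0 1) (lineMat ζ k) = hesseLine ζ k :=
  (Matrix.single_one_vecMul _ _).trans (lineMat_zero ζ k)

lemma Preserves.eq_smul_stabMat_mul_lineMat [CharZero K] {ζ : K} (hζ : IsPrimitiveRoot ζ 3)
    {A : Matrix (Fin 3) (Fin 3) K} (hA : Preserves A (hessianSextic K)) :
    ∃ d k, ∃ t : K, A = t • (stabMat ζ d * lineMat ζ k) := by
  obtain ⟨k, hk⟩ := hA.exists_crossProduct_eq_zero hζ 0
  obtain ⟨s, hs⟩ := eq_smul_hesseLine_of_crossProduct_eq_zero hk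
  have hN := preserves_lineMat hζ k
  obtain ⟨B, hB, rfl⟩ := hA.exists_mul_eq hN
  have h0 : B 0 = s • Pi.single 0 1 := by
    apply Matrix.vecMul_injective_of_isUnit hN.1
    change Matrix.vecMul (B 0) _ = Matrix.vecMul _ _
    rw [← Matrix.mul_apply_eq_vecMul, hs, Matrix.smul_vecMul, single_vecMul_lineMat]
  obtain ⟨d, t, rfl⟩ := hB.eq_smul_stabMat hζ h0
  exact ⟨d, k, t, Matrix.smul_mul _ _ _⟩

lemma stabMat_mul_lineMat_injective [CharZero K] {ζ s : K} (hζ : IsPrimitiveRoot ζ 3)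
    {d e : Fin 3 × Fin 3 × Bool} {k l : Fin 3 ⊕ Fin 3 × Fin 3}
    (h : stabMat ζ e * lineMat ζ l = s • (stabMat ζ d * lineMat ζ k)) : e = d ∧ l = k := by
  have hrow (d k) : (stabMat ζ d * lineMat ζ k) 0 = hesseLine ζ k := by
    rw [Matrix.mul_apply_eq_vecMul, stabMat_zero, single_vecMul_lineMat]
  obtain rfl : l = k := hesseLine_injective hζ (s := s) (by
    rw [← hrow e l, h, ← hrow d k]
    rfl)
  refine ⟨stabMat_injective hζ (s := s) ?_, rfl⟩
  rw [← Matrix.smul_mul] at h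
  exact (preserves_lineMat hζ l).1.mul_right_cancel h

lemma card_planeAut_hessianSextic [CharZero K] {ζ : K} (hζ : IsPrimitiveRoot ζ 3) :
    Nat.card (planeAut (hessianSextic K)) = 216 := by
  have hP (q : (Fin 3 × Fin 3 × Bool) × (Fin 3 ⊕ Fin 3 × Fin 3)) :
      Preserves (stabMat ζ q.1 * lineMat ζ q.2) (hessianSextic K) :=
    (preserves_stabMat hζ q.1).mul (preserves_lineMat hζ q.2)
  have hbij : Function.Bijective fun q : (Fin 3 × Fin 3 × Bool) × (Fin 3 ⊕ Fin 3 × Fin 3) =>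
      (⟨_, (hP q).pgl_mem⟩ : planeAut (hessianSextic K)) := by
    constructor
    · intro q r h
      obtain ⟨s, hs⟩ := (pgl_eq_pgl_iff (hP q).1 (hP r).1).1 (Subtype.ext_iff.1 h)
      obtain ⟨h1, h2⟩ := stabMat_mul_lineMat_injective hζ hs
      exact Prod.ext h1.symm h2.symm
    · rintro ⟨g, hg⟩
      obtain ⟨A, hA, rfl⟩ := exists_preserves_of_mem hg
      obtain ⟨d, k, t, h⟩ := hA.eq_smul_stabMat_mul_lineMat hζ
      exact ⟨(d, k), Subtype.ext ((pgl_eq_pgl_iff (hP (d, k)).1 hA.1).2 ⟨t, h⟩)⟩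
  rw [← Nat.card_eq_of_bijective _ hbij]
  simp

lemma planeAut_hessianSextic_eq_closure [CharZero K] {ζ : K} (hζ : IsPrimitiveRoot ζ 3) :
    planeAut (hessianSextic K) = Subgroup.closure
      {pgl !![1, 0, 0; 0, ζ, 0; 0, 0, ζ⁻¹],
        pgl !![1, 0, 0; 0, 1, 0; 0, 0, ζ],
        pgl (cycleMat K), pgl (fourierMat ζ)} := by
  have h0 : ζ ≠ 0 := hζ.ne_zero (by norm_num)
  have hF := preserves_fourierMat hζ
  apply le_antisymm
  · intro g hg
    obtain ⟨A, hA, rfl⟩ := exists_preserves_of_mem hg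
    obtain ⟨d, k, t, h⟩ := hA.eq_smul_stabMat_mul_lineMat hζ
    have hd := preserves_stabMat hζ d
    have hk := preserves_lineMat hζ k
    rw [← (pgl_eq_pgl_iff (hd.mul hk).1 hA.1).2 ⟨t, h⟩, pgl_mul hd.1 hk.1]
    set H : Subgroup (PGL3 K) := Subgroup.closure _
    have hS : pgl !![1, 0, 0; 0, ζ, 0; 0, 0, ζ⁻¹] ∈ H := Subgroup.subset_closure (by simp)
    have hU : pgl !![1, 0, 0; 0, 1, 0; 0, 0, ζ] ∈ H := Subgroup.subset_closure (by simp)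
    have hT : pgl (cycleMat K) ∈ H := Subgroup.subset_closure (by simp)
    have hV : pgl (fourierMat ζ) ∈ H := Subgroup.subset_closure (by simp)
    have hD (i j : ℕ) : pgl (diagMat ζ i j) ∈ H := by
      have uS : IsUnit !![1, 0, 0; 0, ζ, 0; 0, 0, ζ⁻¹] :=
        isUnit_of_det_ne_zero (by simp [Matrix.det_fin_three, h0])
      have uU : IsUnit !![1, 0, 0; 0, 1, 0; 0, 0, ζ] :=
        isUnit_of_det_ne_zero (by simp [Matrix.det_fin_three, h0])
      rw [diagMat_eq_mul h0, pgl_mul (uS.pow _) (uU.pow _), pgl_pow uS, pgl_pow uU]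
      exact mul_mem (pow_mem hS _) (pow_mem hU _)
    have hW : pgl (swapMat K) ∈ H := by
      rw [(pgl_eq_pgl_iff preserves_swapMat.1 (hF.mul hF).1).2 ⟨3, fourierMat_mul_self hζ⟩,
        pgl_mul hF.1 hF.1]
      exact mul_mem hV hV
    refine mul_mem ?_ ?_
    · obtain ⟨i, j, _ | _⟩ := d
      · simpa [stabMat] using hD i j
      · simpa [stabMat, pgl_mul (preserves_diagMat hζ i j).1 preserves_swapMat.1]
          using mul_mem (hD i j) hW
    · rcases k with k | ⟨i, j⟩
      · rw [lineMat, pgl_pow preserves_cycleMat.1]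
        exact pow_mem hT _
      · rw [lineMat, pgl_mul hF.1 (preserves_diagMat hζ i j).1]
        exact mul_mem hV (hD i j)
  · rw [Subgroup.closure_le]
    rintro _ (rfl | rfl | rfl | rfl)
    · have hS : !![1, 0, 0; 0, ζ, 0; 0, 0, ζ⁻¹] = diagMat ζ 1 2 := by
        rw [diagMat, hζ.inv_eq_sq, pow_one]
      rw [hS]
      exact (preserves_diagMat hζ 1 2).pgl_mem
    · have hU : !![1, 0, 0; 0, 1, 0; 0, 0, ζ] = diagMat ζ 0 1 := by
        rw [diagMat, pow_zero, pow_one]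
      rw [hU]
      exact (preserves_diagMat hζ 0 1).pgl_mem
    · exact preserves_cycleMat.pgl_mem
    · exact hF.pgl_mem

/-- The sextic `X⁶ + Y⁶ + Z⁶ − 10(X³Y³ + Y³Z³ + Z³X³)` is smooth and its
automorphism group is the Hessian group `Hess₂₁₆`, generated by `S = diag(1, ζ₃, ζ₃⁻¹)`,
`U = diag(1, 1, ζ₃)`, `T = [Y:Z:X]` and `V`; in particular it has order `216`. -/
theorem hessian_sextic_automorphisms {K : Type*} [Field K] [IsAlgClosed K] [CharZero K]
    (ζ : K) (hζ : IsPrimitiveRoot ζ 3) :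
    IsSmoothSextic (X 0 ^ 6 + X 1 ^ 6 + X 2 ^ 6
      - 10 * (X 0 ^ 3 * X 1 ^ 3 + X 1 ^ 3 * X 2 ^ 3 + X 2 ^ 3 * X 0 ^ 3) :
        MvPolynomial (Fin 3) K) ∧
    planeAut (X 0 ^ 6 + X 1 ^ 6 + X 2 ^ 6
      - 10 * (X 0 ^ 3 * X 1 ^ 3 + X 1 ^ 3 * X 2 ^ 3 + X 2 ^ 3 * X 0 ^ 3) :
        MvPolynomial (Fin 3) K) = Subgroup.closure
      {pgl !![1, 0, 0; 0, ζ, 0; 0, 0, ζ⁻¹],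
        pgl !![1, 0, 0; 0, 1, 0; 0, 0, ζ],
        pgl !![(0 : K), 1, 0; 0, 0, 1; 1, 0, 0],
        pgl !![1, 1, 1; 1, ζ, ζ⁻¹; 1, ζ⁻¹, ζ]} ∧
    Nat.card ↥(planeAut (X 0 ^ 6 + X 1 ^ 6 + X 2 ^ 6
      - 10 * (X 0 ^ 3 * X 1 ^ 3 + X 1 ^ 3 * X 2 ^ 3 + X 2 ^ 3 * X 0 ^ 3) :
        MvPolynomial (Fin 3) K)) = 216 := by
  exact ⟨isSmoothSextic_hessianSextic, planeAut_hessianSextic_eq_closure hζ,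
    card_planeAut_hessianSextic hζ⟩
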